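/- Let α = (α_1,…,α_t) be palindromic (α_i = α_{t+1−i} for all i) with t odd, let F = F̆(α) with elements x_1,…,x_n where n = #F, and suppose that for every i ∈ {1,…,t−1} the statistic χ_{s_i} − χ_{s_{t−i}} is 0-mesic under rowmotion on J(F). Then: (1) for every k ∈ {1,…,n}, the statistic χ_{x_k} − χ_{x_{n−k+1}} is 0-mesic under rowmotion; and (2) for every k ∈ {1,…,n}, the statistic χ̂_{x_k} + χ̂_{x_{n−k+1}} is 1-mesic under rowmotion. -/

import Mathlib

open scoped Classical

namespace Fence

/-- partial sums: `m α i = α 0 + ⋯ + α (i-1)` (the paper's `m_i`). -/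
def m (α : ℕ → ℕ) (i : ℕ) : ℕ := ∑ k ∈ Finset.range i, α k

/-- the number `n` of elements of the fence `F̆(α)`. -/
def nn (t : ℕ) (α : ℕ → ℕ) : ℕ := m α t - 1

/-- vertex type: index `0` is a dummy (used as sentinel for nonexistent elements);
the fence elements are the indices `1,…,nn t α`. -/
abbrev V (t : ℕ) (α : ℕ → ℕ) := Fin (nn t α + 1)

/-- the element `x_j` (1-based). -/
def xel (t : ℕ) (α : ℕ → ℕ) (j : ℕ) : V t α :=
  ⟨j % (nn t α + 1), Nat.mod_lt _ (Nat.succ_pos _)⟩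

/-- `p` is an actual element of the fence (not the dummy `0`). -/
def Elem (t : ℕ) (α : ℕ → ℕ) (p : V t α) : Prop := 1 ≤ (p : ℕ)

/-- the conditions on `(t, α)` for `F̆(α)` to be a fence. -/
def IsFence (t : ℕ) (α : ℕ → ℕ) : Prop :=
  2 ≤ t ∧ (∀ i < t, 1 ≤ α i) ∧ 2 ≤ α 0 ∧ 2 ≤ α (t - 1)

/-- the covering relation of the fence: `Cov t α a b` means `a ⋖ b`. -/
def Cov (t : ℕ) (α : ℕ → ℕ) (a b : V t α) : Prop :=
  ∃ i < t, ((i % 2 = 0 ∧ (b : ℕ) = (a : ℕ) + 1) ∨ (i % 2 = 1 ∧ (a : ℕ) = (b : ℕ) + 1)) ∧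
    m α i ≤ min (a : ℕ) (b : ℕ) ∧ min (a : ℕ) (b : ℕ) < m α (i + 1) ∧
    1 ≤ min (a : ℕ) (b : ℕ) ∧ max (a : ℕ) (b : ℕ) ≤ nn t α

/-- the order of the fence: reflexive–transitive closure of the covering relation. -/
def Le (t : ℕ) (α : ℕ → ℕ) : V t α → V t α → Prop := Relation.ReflTransGen (Cov t α)

/-- order ideals of the fence (as sets of actual elements, downward closed). -/
def IsIdeal (t : ℕ) (α : ℕ → ℕ) (I : Set (V t α)) : Prop :=
  (∀ p ∈ I, Elem t α p) ∧ ∀ a b : V t α, Le t α a b → b ∈ I → a ∈ I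

/-- `J t α` is the set of order ideals of the fence. -/
abbrev J (t : ℕ) (α : ℕ → ℕ) := {I : Set (V t α) // IsIdeal t α I}

/-- `p` is a maximal element of the set `I`. -/
def MaxIn (t : ℕ) (α : ℕ → ℕ) (I : Set (V t α)) (p : V t α) : Prop :=
  p ∈ I ∧ ∀ q ∈ I, Le t α p q → q = p

/-- `p` is a minimal element of the complement of `I` (among actual elements). -/
def MinOut (t : ℕ) (α : ℕ → ℕ) (I : Set (V t α)) (p : V t α) : Prop :=
  Elem t α p ∧ p ∉ I ∧ ∀ q : V t α, Elem t α q → q ∉ I → Le t α q p → q = p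

/-- the order-ideal indicator function `χ̂_p`. -/
noncomputable def chiHat (t : ℕ) (α : ℕ → ℕ) (p : V t α) (I : J t α) : ℝ :=
  if p ∈ I.1 then 1 else 0

/-- the antichain indicator function `χ_p`. -/
noncomputable def chi (t : ℕ) (α : ℕ → ℕ) (p : V t α) (I : J t α) : ℝ :=
  if MaxIn t α I.1 p then 1 else 0

/-- the toggleability statistic `T_p`. -/
noncomputable def Tg (t : ℕ) (α : ℕ → ℕ) (p : V t α) (I : J t α) : ℝ :=
  if MinOut t α I.1 p then 1 else if MaxIn t α I.1 p then -1 else 0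

/-- the antichain toggleability statistic `T_A`. -/
noncomputable def TA (t : ℕ) (α : ℕ → ℕ) (A : Set (V t α)) (I : J t α) : ℝ :=
  if ∀ p ∈ A, MinOut t α I.1 p then 1 else if ∀ p ∈ A, MaxIn t α I.1 p then -1 else 0

/-- `#[a,b]`: the number of elements `r` with `a ⊴ r ⊴ b`. -/
noncomputable def icard (t : ℕ) (α : ℕ → ℕ) (a b : V t α) : ℕ :=
  Set.ncard {r : V t α | Elem t α r ∧ Le t α a r ∧ Le t α r b}

/-- the span of the toggleability statistics `{T_p : p ∈ F}`. -/
noncomputable def ToggSpan (t : ℕ) (α : ℕ → ℕ) : Submodule ℝ (J t α → ℝ) :=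
  Submodule.span ℝ {f | ∃ p : V t α, Elem t α p ∧ f = Tg t α p}

/-- `f ≡ g`: `f - g` is an `ℝ`-linear combination of toggleability statistics. -/
def Equiv' (t : ℕ) (α : ℕ → ℕ) (f g : J t α → ℝ) : Prop := f - g ∈ ToggSpan t α

/-- statistics of the form `const + linear combination of toggleability statistics`. -/
noncomputable def ConstPlusTogg (t : ℕ) (α : ℕ → ℕ) : Submodule ℝ (J t α → ℝ) :=
  ToggSpan t α ⊔ Submodule.span ℝ {fun _ : J t α => (1 : ℝ)}

/-- the span of the antichain indicator functions `{χ_p : p ∈ F}`. -/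
noncomputable def chiSpan (t : ℕ) (α : ℕ → ℕ) : Submodule ℝ (J t α → ℝ) :=
  Submodule.span ℝ {f | ∃ p : V t α, Elem t α p ∧ f = chi t α p}

/-- the span of the order-ideal indicator functions `{χ̂_p : p ∈ F}`. -/
noncomputable def chiHatSpan (t : ℕ) (α : ℕ → ℕ) : Submodule ℝ (J t α → ℝ) :=
  Submodule.span ℝ {f | ∃ p : V t α, Elem t α p ∧ f = chiHat t α p}

/-- the antichain toggleability space `A_T(F)`. -/
noncomputable def AT (t : ℕ) (α : ℕ → ℕ) : Submodule ℝ (J t α → ℝ) :=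
  chiSpan t α ⊓ ConstPlusTogg t α

/-- the order ideal toggleability space `I_T(F)`. -/
noncomputable def IT (t : ℕ) (α : ℕ → ℕ) : Submodule ℝ (J t α → ℝ) :=
  chiHatSpan t α ⊓ ConstPlusTogg t α

/-- the shared element `s_i = x_{m_i}` (for `1 ≤ i ≤ t-1`); the sentinels `i = 0` and
`i = t` give the dummy vertex `0`, so statistics indexed by them vanish. -/
def sElx (t : ℕ) (α : ℕ → ℕ) (i : ℕ) : V t α := xel t α (m α i)

/-- 1-based index of the unshared element `s_{(i,j)}` (the `j`-th smallest unshared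
element of the segment `S_i`, in the order of the fence). -/
def uEl (α : ℕ → ℕ) (i j : ℕ) : ℕ :=
  if (i - 1) % 2 = 0 then m α (i - 1) + j else m α i - j

def uElx (t : ℕ) (α : ℕ → ℕ) (i j : ℕ) : V t α := xel t α (uEl α i j)

/-- 1-based index of the peak of segment `S_i` (sentinel `0` if it does not exist). -/
def peakN (t : ℕ) (α : ℕ → ℕ) (i : ℕ) : ℕ :=
  if i % 2 = 1 then (if i + 1 ≤ t then m α i else 0) else m α (i - 1)

/-- 1-based index of the valley of segment `S_i` (sentinel `0` if it does not exist). -/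
def valleyN (t : ℕ) (α : ℕ → ℕ) (i : ℕ) : ℕ :=
  if i % 2 = 1 then (if 2 ≤ i then m α (i - 1) else 0) else (if i + 1 ≤ t then m α i else 0)

def peakx (t : ℕ) (α : ℕ → ℕ) (i : ℕ) : V t α := xel t α (peakN t α i)
def valleyx (t : ℕ) (α : ℕ → ℕ) (i : ℕ) : V t α := xel t α (valleyN t α i)

/-- segment `S_i` has a peak. -/
def HasPeak (t i : ℕ) : Prop := i % 2 = 0 ∨ i + 1 ≤ t

/-- segment `S_i` has a valley. -/
def HasValley (t i : ℕ) : Prop := (i % 2 = 1 ∧ 2 ≤ i) ∨ (i % 2 = 0 ∧ i + 1 ≤ t)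

/-- `p` is a shared element of the fence. -/
def IsSharedElem (t : ℕ) (α : ℕ → ℕ) (p : V t α) : Prop :=
  ∃ i, 1 ≤ i ∧ i + 1 ≤ t ∧ p = sElx t α i

/-- `p` is a peak of the fence. -/
def IsPeakElem (t : ℕ) (α : ℕ → ℕ) (p : V t α) : Prop :=
  ∃ i, 1 ≤ i ∧ i + 1 ≤ t ∧ i % 2 = 1 ∧ p = sElx t α i

/-- span of the antichain indicators of the shared elements. -/
noncomputable def chiSharedSpan (t : ℕ) (α : ℕ → ℕ) : Submodule ℝ (J t α → ℝ) :=
  Submodule.span ℝ {f | ∃ i, 1 ≤ i ∧ i + 1 ≤ t ∧ f = chi t α (sElx t α i)}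

/-- span of the order-ideal indicators of the shared elements. -/
noncomputable def chiHatSharedSpan (t : ℕ) (α : ℕ → ℕ) : Submodule ℝ (J t α → ℝ) :=
  Submodule.span ℝ {f | ∃ i, 1 ≤ i ∧ i + 1 ≤ t ∧ f = chiHat t α (sElx t α i)}

theorem cov_elem {t : ℕ} {α : ℕ → ℕ} {a b : V t α} (h : Cov t α a b) :
    Elem t α a ∧ Elem t α b := by
  obtain ⟨i, hi, hd, h1, h2, h3, h4⟩ := h
  constructor <;> (simp only [Elem]; omega)

theorem le_elem {t : ℕ} {α : ℕ → ℕ} {a b : V t α} (h : Le t α a b) (hb : Elem t α b) :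
    Elem t α a := by
  induction h using Relation.ReflTransGen.head_induction_on with
  | refl => exact hb
  | head hc _ _ => exact (cov_elem hc).1

/-- rowmotion: `ρ(I)` is the order ideal generated by the minimal elements of the
complement of `I`. -/
noncomputable def rho (t : ℕ) (α : ℕ → ℕ) (I : J t α) : J t α :=
  ⟨{q | ∃ p : V t α, MinOut t α I.1 p ∧ Le t α q p}, by
    constructor
    · rintro q ⟨p, hp, hle⟩
      exact le_elem hle hp.1
    · rintro a b hab ⟨p, hp, hle⟩
      exact ⟨p, hp, Relation.ReflTransGen.trans hab hle⟩⟩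

/-- the (forward) orbit of `x` under `ρ`. -/
def orbit {X : Type*} (ρ : X → X) (x : X) : Set X := {y | ∃ k : ℕ, ρ^[k] x = y}

/-- `f` is `c`-mesic under `ρ`: the sum of `f` over each orbit is `c` times
the orbit size. -/
def IsMesic {X : Type*} (ρ : X → X) (f : X → ℝ) (c : ℝ) : Prop :=
  ∀ x : X, ∑ᶠ y ∈ orbit ρ x, f y = (orbit ρ x).ncard * c


/-! ### Auxiliary material for the proof -/

/-- the step from `x_j` to `x_{j+1}` goes up. -/
def Up (t : ℕ) (α : ℕ → ℕ) (j : ℕ) : Prop := ∃ i < t, i % 2 = 0 ∧ m α i ≤ j ∧ j < m α (i + 1)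

/-- the step from `x_j` to `x_{j+1}` goes down. -/
def Dn (t : ℕ) (α : ℕ → ℕ) (j : ℕ) : Prop := ∃ i < t, i % 2 = 1 ∧ m α i ≤ j ∧ j < m α (i + 1)

theorem m_succ (α : ℕ → ℕ) (i : ℕ) : m α (i + 1) = m α i + α i := by
  simp [m, Finset.sum_range_succ]

theorem m_zero (α : ℕ → ℕ) : m α 0 = 0 := by simp [m]

theorem m_mono (α : ℕ → ℕ) : Monotone (m α) :=
  monotone_nat_of_le_succ fun i => by rw [m_succ]; omega

theorem seg_unique {α : ℕ → ℕ} {i i' j : ℕ} (h1 : m α i ≤ j) (h2 : j < m α (i + 1))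
    (h1' : m α i' ≤ j) (h2' : j < m α (i' + 1)) : i = i' := by
  rcases lt_trichotomy i i' with h | h | h
  · have := m_mono α (show i + 1 ≤ i' from h); omega
  · exact h
  · have := m_mono α (show i' + 1 ≤ i from h); omega

theorem up_iff {t : ℕ} {α : ℕ → ℕ} {i j : ℕ} (hi : i < t) (h1 : m α i ≤ j)
    (h2 : j < m α (i + 1)) : Up t α j ↔ i % 2 = 0 := by
  constructor
  · rintro ⟨i', _, h, h3, h4⟩
    rw [seg_unique h1 h2 h3 h4]; exact h
  · intro h; exact ⟨i, hi, h, h1, h2⟩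

theorem dn_iff {t : ℕ} {α : ℕ → ℕ} {i j : ℕ} (hi : i < t) (h1 : m α i ≤ j)
    (h2 : j < m α (i + 1)) : Dn t α j ↔ i % 2 = 1 := by
  constructor
  · rintro ⟨i', _, h, h3, h4⟩
    rw [seg_unique h1 h2 h3 h4]; exact h
  · intro h; exact ⟨i, hi, h, h1, h2⟩

theorem not_up_of_dn {t : ℕ} {α : ℕ → ℕ} {j : ℕ} (h : Dn t α j) : ¬ Up t α j := by
  obtain ⟨i, hi, h, h1, h2⟩ := h
  rw [up_iff hi h1 h2]; omega

theorem exists_seg (t : ℕ) (α : ℕ → ℕ) (j : ℕ) (h : j < m α t) :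
    ∃ i < t, m α i ≤ j ∧ j < m α (i + 1) := by
  induction t with
  | zero => simp [m_zero] at h
  | succ t ih =>
    by_cases h' : j < m α t
    · obtain ⟨i, hi, h⟩ := ih h'
      exact ⟨i, by omega, h⟩
    · exact ⟨t, by omega, by omega, h⟩

theorem cov_iff {t : ℕ} {α : ℕ → ℕ} (a b : V t α) : Cov t α a b ↔
    (1 ≤ (a : ℕ) ∧ (b : ℕ) = a + 1 ∧ Up t α a) ∨ (1 ≤ (b : ℕ) ∧ (a : ℕ) = b + 1 ∧ Dn t α b) := by
  have ha := a.2
  have hb := b.2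
  constructor
  · rintro ⟨i, hi, hd, h1, h2, h3, h4⟩
    rcases hd with ⟨hp, hd⟩ | ⟨hp, hd⟩
    · left
      rw [min_eq_left (by omega)] at *
      exact ⟨h3, hd, i, hi, hp, h1, h2⟩
    · right
      rw [min_eq_right (by omega)] at *
      exact ⟨h3, hd, i, hi, hp, h1, h2⟩
  · rintro (⟨h1, h2, i, hi, hp, h3, h4⟩ | ⟨h1, h2, i, hi, hp, h3, h4⟩)
    · exact ⟨i, hi, Or.inl ⟨hp, h2⟩, by omega, by omega, by omega, by omega⟩
    · exact ⟨i, hi, Or.inr ⟨hp, h2⟩, by omega, by omega, by omega, by omega⟩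

/-- a height function, increasing by one along covers. -/
noncomputable def ht (t : ℕ) (α : ℕ → ℕ) (j : ℕ) : ℤ :=
  ∑ k ∈ Finset.range j, if Up t α k then 1 else -1

theorem ht_cov {t : ℕ} {α : ℕ → ℕ} {a b : V t α} (h : Cov t α a b) :
    ht t α a < ht t α b := by
  rw [cov_iff] at h
  rcases h with ⟨_, h2, h3⟩ | ⟨_, h2, h3⟩
  · rw [h2]; simp [ht, Finset.sum_range_succ, h3]
  · rw [h2]; simp [ht, Finset.sum_range_succ, not_up_of_dn h3]

theorem ht_le {t : ℕ} {α : ℕ → ℕ} {a b : V t α} (h : Le t α a b) :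
    a = b ∨ ht t α a < ht t α b := by
  induction h with
  | refl => left; rfl
  | tail _ hc ih =>
    right
    have := ht_cov hc
    rcases ih with rfl | ih
    · exact this
    · exact ih.trans this

theorem maxIn_iff {t : ℕ} {α : ℕ → ℕ} (I : J t α) (p : V t α) :
    MaxIn t α I.1 p ↔ p ∈ I.1 ∧ ∀ q, Cov t α p q → q ∉ I.1 := by
  constructor
  · rintro ⟨h1, h2⟩
    refine ⟨h1, fun q hc hq => ?_⟩
    have := h2 q hq (Relation.ReflTransGen.single hc)
    have h3 := ht_cov hc
    rw [this] at h3
    exact lt_irrefl _ h3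
  · rintro ⟨h1, h2⟩
    refine ⟨h1, fun q hq hle => ?_⟩
    rcases Relation.ReflTransGen.cases_head hle with h | ⟨r, hc, hr⟩
    · exact h.symm
    · exact absurd (I.2.2 r q hr hq) (h2 r hc)

theorem minOut_iff {t : ℕ} {α : ℕ → ℕ} (I : J t α) (p : V t α) :
    MinOut t α I.1 p ↔ Elem t α p ∧ p ∉ I.1 ∧ ∀ q, Cov t α q p → q ∈ I.1 := by
  constructor
  · rintro ⟨h0, h1, h2⟩
    refine ⟨h0, h1, fun q hc => ?_⟩
    by_contra hq
    have := h2 q (cov_elem hc).1 hq (Relation.ReflTransGen.single hc)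
    have h3 := ht_cov hc
    rw [this] at h3
    exact lt_irrefl _ h3
  · rintro ⟨h0, h1, h2⟩
    refine ⟨h0, h1, fun q _ hq hle => ?_⟩
    rcases Relation.ReflTransGen.cases_tail hle with h | ⟨r, hr, hc⟩
    · exact h.symm
    · exact absurd (I.2.2 q r hr (h2 r hc)) hq

theorem maxIn_rho {t : ℕ} {α : ℕ → ℕ} (I : J t α) (p : V t α) :
    MaxIn t α (rho t α I).1 p ↔ MinOut t α I.1 p := by
  constructor
  · rintro ⟨⟨p', hp', hle⟩, h2⟩
    have := h2 p' ⟨p', hp', Relation.ReflTransGen.refl⟩ hle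
    rwa [← this]
  · intro hp
    refine ⟨⟨p, hp, Relation.ReflTransGen.refl⟩, ?_⟩
    rintro q ⟨p', hp', hle⟩ hpq
    have e : p = p' := hp'.2.2 p hp.1 hp.2.1 (hpq.trans hle)
    subst e
    refine hp.2.2 q (le_elem hle hp.1) (fun hq => hp.2.1 (I.2.2 _ _ hpq hq)) hle

theorem exists_minOut {t : ℕ} {α : ℕ → ℕ} (I : J t α) (q : V t α) (hq : Elem t α q)
    (hI : q ∉ I.1) : ∃ p, MinOut t α I.1 p ∧ Le t α p q := by
  obtain ⟨p, ⟨hp1, hp2⟩, hmin⟩ := Set.exists_min_image {p : V t α | p ∉ I.1 ∧ Le t α p q}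
    (fun p => ht t α p) (Set.toFinite _) ⟨q, hI, Relation.ReflTransGen.refl⟩
  refine ⟨p, ⟨le_elem hp2 hq, hp1, fun r _ hr hle => ?_⟩, hp2⟩
  rcases ht_le hle with h | h
  · exact h
  · exact absurd (hmin r ⟨hr, hle.trans hp2⟩) (not_le.mpr h)

theorem mem_iff_minOut {t : ℕ} {α : ℕ → ℕ} (I : J t α) (q : V t α) :
    q ∈ I.1 ↔ Elem t α q ∧ ¬ ∃ p, MinOut t α I.1 p ∧ Le t α p q := by
  constructor
  · intro h
    refine ⟨I.2.1 q h, ?_⟩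
    rintro ⟨p, hp, hle⟩
    exact hp.2.1 (I.2.2 _ _ hle h)
  · rintro ⟨h1, h2⟩
    by_contra h
    exact h2 (exists_minOut I q h1 h)

theorem rho_injective (t : ℕ) (α : ℕ → ℕ) : Function.Injective (rho t α) := by
  intro I I' h
  apply Subtype.ext
  ext q
  rw [mem_iff_minOut, mem_iff_minOut]
  have : ∀ p, MinOut t α I.1 p ↔ MinOut t α I'.1 p := fun p => by
    rw [← maxIn_rho, ← maxIn_rho, h]
  simp only [this]

/-- the orbit of `x` as a finset. -/
noncomputable def orb {t : ℕ} {α : ℕ → ℕ} (x : J t α) : Finset (J t α) :=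
  (Set.toFinite (orbit (rho t α) x)).toFinset

theorem isMesic_iff {t : ℕ} {α : ℕ → ℕ} (f : J t α → ℝ) (c : ℝ) :
    IsMesic (rho t α) f c ↔ ∀ x, ∑ y ∈ orb x, f y = (orb x).card * c := by
  unfold IsMesic
  refine forall_congr' fun x => ?_
  rw [finsum_mem_eq_finite_toFinset_sum _ (Set.toFinite (orbit (rho t α) x)),
    Set.ncard_eq_toFinset_card _ (Set.toFinite (orbit (rho t α) x))]
  rfl

theorem orb_shift {t : ℕ} {α : ℕ → ℕ} (x : J t α) (f : J t α → ℝ) :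
    ∑ y ∈ orb x, f (rho t α y) = ∑ y ∈ orb x, f y := by
  have himg : (orb x).image (rho t α) = orb x := by
    apply Finset.eq_of_subset_of_card_le
    · intro y hy
      simp only [Finset.mem_image, orb, Set.Finite.mem_toFinset] at hy ⊢
      obtain ⟨z, ⟨k, hk⟩, rfl⟩ := hy
      exact ⟨k + 1, by rw [Function.iterate_succ_apply', hk]⟩
    · rw [Finset.card_image_of_injective _ (rho_injective t α)]
  conv_rhs => rw [← himg]
  rw [Finset.sum_image (fun a _ b _ h => rho_injective t α h)]

/-- extended membership with virtual bottom `0` (in) and virtual top `n+1` (out). -/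
def Mem' {t : ℕ} {α : ℕ → ℕ} (I : J t α) (j : ℕ) : Prop :=
  j = 0 ∨ (1 ≤ j ∧ j ≤ nn t α ∧ xel t α j ∈ I.1)

theorem xel_val {t : ℕ} {α : ℕ → ℕ} {j : ℕ} (h : j ≤ nn t α) : (xel t α j : ℕ) = j :=
  Nat.mod_eq_of_lt (by omega)

theorem eq_xel {t : ℕ} {α : ℕ → ℕ} (q : V t α) : q = xel t α q :=
  Fin.ext (xel_val (by have := q.2; omega)).symm

theorem mem'_iff {t : ℕ} {α : ℕ → ℕ} (I : J t α) (q : V t α) (h : 1 ≤ (q : ℕ)) :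
    Mem' I q ↔ q ∈ I.1 := by
  have := q.2
  unfold Mem'
  rw [← eq_xel]
  constructor
  · rintro (h | h)
    · omega
    · exact h.2.2
  · intro h'; exact Or.inr ⟨h, by omega, h'⟩

theorem mem'_zero {t : ℕ} {α : ℕ → ℕ} (I : J t α) : Mem' I 0 := Or.inl rfl

theorem mem'_top {t : ℕ} {α : ℕ → ℕ} (I : J t α) (j : ℕ) (h : nn t α < j) : ¬ Mem' I j := by
  rintro (h | h) <;> omega

section
variable {t : ℕ} {α : ℕ → ℕ}

theorem nn_add (hF : IsFence t α) : nn t α + 1 = m α t := by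
  obtain ⟨h1, h2, h3, h4⟩ := hF
  have := m_mono α (show 1 ≤ t by omega)
  have h := m_succ α 0
  simp only [m_zero, zero_add] at h
  unfold nn; omega

theorem not_dn_zero (hF : IsFence t α) : ¬ Dn t α 0 := by
  obtain ⟨h1, h2, h3, h4⟩ := hF
  have h := m_succ α 0
  simp only [m_zero, zero_add] at h
  rw [dn_iff (i := 0) (by omega) (by simp [m_zero]) (by simp only [zero_add]; omega)]
  omega

theorem not_dn_top (hF : IsFence t α) (hodd : t % 2 = 1) : ¬ Dn t α (nn t α) := by
  have hn := nn_add hF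
  obtain ⟨h1, h2, h3, h4⟩ := hF
  have h := m_succ α (t - 1)
  rw [show t - 1 + 1 = t by omega] at h
  rw [dn_iff (i := t - 1) (by omega) (by omega) (by rw [show t - 1 + 1 = t by omega]; omega)]
  omega

theorem maxIn_xel (hF : IsFence t α) (I : J t α) (j : ℕ) (h1 : 1 ≤ j)
    (h2 : j ≤ nn t α) : MaxIn t α I.1 (xel t α j) ↔
      Mem' I j ∧ (Up t α j → ¬ Mem' I (j + 1)) ∧ (Dn t α (j - 1) → ¬ Mem' I (j - 1)) := by
  have hv := xel_val (t := t) (α := α) h2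
  rw [maxIn_iff, ← mem'_iff I _ (by omega), hv]
  refine and_congr_right fun _ => ?_
  constructor
  · intro h
    constructor
    · intro hu hm
      by_cases hj : j + 1 ≤ nn t α
      · have hv' := xel_val (t := t) (α := α) hj
        refine h (xel t α (j + 1)) ?_ ?_
        · rw [cov_iff]; left; rw [hv, hv']; exact ⟨h1, rfl, hu⟩
        · rw [← mem'_iff _ _ (by omega), hv']; exact hm
      · exact mem'_top I _ (by omega) hm
    · intro hd hm
      by_cases hj : j = 1
      · subst hj; exact not_dn_zero hF hd
      · have hv' := xel_val (t := t) (α := α) (show j - 1 ≤ nn t α by omega)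
        refine h (xel t α (j - 1)) ?_ ?_
        · rw [cov_iff]; right; rw [hv, hv']; exact ⟨by omega, by omega, hd⟩
        · rw [← mem'_iff _ _ (by omega), hv']; exact hm
  · rintro ⟨ha, hb⟩ q hc
    rw [cov_iff, hv] at hc
    rw [← mem'_iff I q (by omega)]
    rcases hc with ⟨_, hq, hu⟩ | ⟨_, hq, hd⟩
    · rw [hq]; exact ha hu
    · rw [show (q : ℕ) = j - 1 by omega] at hd ⊢; exact hb hd

theorem minOut_xel (hF : IsFence t α) (hodd : t % 2 = 1) (I : J t α) (j : ℕ) (h1 : 1 ≤ j)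
    (h2 : j ≤ nn t α) : MinOut t α I.1 (xel t α j) ↔
      ¬ Mem' I j ∧ (Dn t α j → Mem' I (j + 1)) ∧ (Up t α (j - 1) → Mem' I (j - 1)) := by
  have hv := xel_val (t := t) (α := α) h2
  rw [minOut_iff, ← mem'_iff I _ (by omega), hv]
  have he : Elem t α (xel t α j) := by unfold Elem; omega
  simp only [he, true_and]
  refine and_congr_right fun _ => ?_
  constructor
  · intro h
    constructor
    · intro hd
      by_cases hj : j + 1 ≤ nn t α
      · have hv' := xel_val (t := t) (α := α) hj
        have := h (xel t α (j + 1)) (by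
          rw [cov_iff]; right; rw [hv, hv']; exact ⟨h1, rfl, hd⟩)
        rwa [← mem'_iff _ _ (by omega), hv'] at this
      · rw [show j = nn t α by omega] at hd
        exact absurd hd (not_dn_top hF hodd)
    · intro hu
      by_cases hj : j = 1
      · subst hj; exact mem'_zero I
      · have hv' := xel_val (t := t) (α := α) (show j - 1 ≤ nn t α by omega)
        have := h (xel t α (j - 1)) (by
          rw [cov_iff]; left; rw [hv, hv']; exact ⟨by omega, by omega, hu⟩)
        rwa [← mem'_iff _ _ (by omega), hv'] at this
  · rintro ⟨ha, hb⟩ q hc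
    have hq1 : 1 ≤ (q : ℕ) := (cov_elem hc).1
    rw [cov_iff, hv] at hc
    rw [← mem'_iff I q hq1]
    rcases hc with ⟨_, hq, hu⟩ | ⟨_, hq, hd⟩
    · rw [show (q : ℕ) = j - 1 by omega] at hu ⊢; exact hb hu
    · rw [hq]; exact ha hd

theorem mem'_up (I : J t α) (j : ℕ) (hu : Up t α j) (h : Mem' I (j + 1)) : Mem' I j := by
  rcases h with h | ⟨h1, h2, h3⟩
  · omega
  rcases Nat.eq_zero_or_pos j with rfl | hj
  · exact mem'_zero I
  have hv := xel_val (t := t) (α := α) h2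
  have hv' := xel_val (t := t) (α := α) (show j ≤ nn t α by omega)
  refine Or.inr ⟨hj, by omega, I.2.2 _ _ (Relation.ReflTransGen.single ?_) h3⟩
  rw [cov_iff]; left; rw [hv, hv']; exact ⟨hj, rfl, hu⟩

theorem mem'_dn (hF : IsFence t α) (hodd : t % 2 = 1) (I : J t α) (j : ℕ) (hd : Dn t α j)
    (h : Mem' I j) : Mem' I (j + 1) := by
  rcases h with rfl | ⟨h1, h2, h3⟩
  · exact absurd hd (not_dn_zero hF)
  by_cases hj : j + 1 ≤ nn t α
  · have hv := xel_val (t := t) (α := α) h2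
    have hv' := xel_val (t := t) (α := α) hj
    refine Or.inr ⟨by omega, hj, I.2.2 _ _ (Relation.ReflTransGen.single ?_) h3⟩
    rw [cov_iff]; right; rw [hv, hv']; exact ⟨h1, rfl, hd⟩
  · rw [show j = nn t α by omega] at hd
    exact absurd hd (not_dn_top hF hodd)

/-- real-valued extended indicator. -/
noncomputable def hh (j : ℕ) (I : J t α) : ℝ := if Mem' I j then 1 else 0

/-- orbit sum of the extended indicator. -/
noncomputable def HH (x : J t α) (j : ℕ) : ℝ := ∑ I ∈ orb x, hh j I

/-- orbit sum of the antichain indicator. -/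
noncomputable def CC (x : J t α) (j : ℕ) : ℝ := ∑ I ∈ orb x, chi t α (xel t α j) I

theorem chi_rho (x : J t α) (j : ℕ) :
    CC x j = ∑ I ∈ orb x, if MinOut t α I.1 (xel t α j) then (1 : ℝ) else 0 := by
  unfold CC
  rw [← orb_shift]
  simp only [chi, maxIn_rho]

theorem hh_eq (j : ℕ) (h1 : 1 ≤ j) (h2 : j ≤ nn t α) (I : J t α) :
    chiHat t α (xel t α j) I = hh j I := by
  have hv := xel_val (t := t) (α := α) h2
  unfold chiHat hh
  rw [← mem'_iff I _ (by omega), hv]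

theorem interior_up (hF : IsFence t α) (hodd : t % 2 = 1) (x : J t α) (i j : ℕ) (hi : i < t)
    (h1 : m α i < j) (h2 : j < m α (i + 1)) (hp : i % 2 = 0) :
    CC x j = HH x j - HH x (j + 1) ∧ CC x j = HH x (j - 1) - HH x j := by
  have hn := nn_add hF
  have hle := m_mono α (show i + 1 ≤ t from hi)
  have u1 : Up t α j := (up_iff hi h1.le h2).2 hp
  have u2 : Up t α (j - 1) := (up_iff hi (by omega) (by omega)).2 hp
  have d1 : ¬ Dn t α j := by rw [dn_iff hi h1.le h2]; omega
  have d2 : ¬ Dn t α (j - 1) := by rw [dn_iff hi (by omega) (by omega)]; omega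
  constructor
  · unfold CC HH
    rw [← Finset.sum_sub_distrib]
    refine Finset.sum_congr rfl fun I _ => ?_
    have := mem'_up I j u1
    unfold chi hh
    rw [maxIn_xel hF I j (by omega) (by omega)]
    by_cases ha : Mem' I j <;> by_cases hb : Mem' I (j + 1) <;> simp_all
  · rw [chi_rho]
    unfold HH
    rw [← Finset.sum_sub_distrib]
    refine Finset.sum_congr rfl fun I _ => ?_
    have := mem'_up I (j - 1) u2
    rw [show j - 1 + 1 = j by omega] at this
    unfold hh
    rw [minOut_xel hF hodd I j (by omega) (by omega)]
    by_cases ha : Mem' I j <;> by_cases hb : Mem' I (j - 1) <;> simp_all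

theorem interior_dn (hF : IsFence t α) (hodd : t % 2 = 1) (x : J t α) (i j : ℕ) (hi : i < t)
    (h1 : m α i < j) (h2 : j < m α (i + 1)) (hp : i % 2 = 1) :
    CC x j = HH x j - HH x (j - 1) ∧ CC x j = HH x (j + 1) - HH x j := by
  have hn := nn_add hF
  have hle := m_mono α (show i + 1 ≤ t from hi)
  have u1 : Dn t α j := (dn_iff hi h1.le h2).2 hp
  have u2 : Dn t α (j - 1) := (dn_iff hi (by omega) (by omega)).2 hp
  have d1 : ¬ Up t α j := by rw [up_iff hi h1.le h2]; omega
  have d2 : ¬ Up t α (j - 1) := by rw [up_iff hi (by omega) (by omega)]; omega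
  constructor
  · unfold CC HH
    rw [← Finset.sum_sub_distrib]
    refine Finset.sum_congr rfl fun I _ => ?_
    have := mem'_dn hF hodd I (j - 1) u2
    rw [show j - 1 + 1 = j by omega] at this
    unfold chi hh
    rw [maxIn_xel hF I j (by omega) (by omega)]
    by_cases ha : Mem' I j <;> by_cases hb : Mem' I (j - 1) <;> simp_all
  · rw [chi_rho]
    unfold HH
    rw [← Finset.sum_sub_distrib]
    refine Finset.sum_congr rfl fun I _ => ?_
    have := mem'_dn hF hodd I j u1
    unfold hh
    rw [minOut_xel hF hodd I j (by omega) (by omega)]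
    by_cases ha : Mem' I j <;> by_cases hb : Mem' I (j + 1) <;> simp_all

theorem seg_pos (hF : IsFence t α) (i : ℕ) (h : i < t) : m α i < m α (i + 1) := by
  rw [m_succ]; have := hF.2.1 i h; omega

theorem at_peak (hF : IsFence t α) (x : J t α) (i : ℕ) (h1 : 1 ≤ i)
    (h2 : i < t) (hp : i % 2 = 1) : CC x (m α i) = HH x (m α i) := by
  have hn := nn_add hF
  have hs := seg_pos hF i h2
  have hs' := seg_pos hF (i - 1) (by omega)
  have hle := m_mono α (show i + 1 ≤ t from h2)
  have e : i - 1 + 1 = i := by omega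
  rw [e] at hs'
  have d1 : ¬ Up t α (m α i) := by rw [up_iff h2 le_rfl hs]; omega
  have d2 : ¬ Dn t α (m α i - 1) := by
    rw [dn_iff (i := i - 1) (by omega) (by omega) (by rw [e]; omega)]; omega
  unfold CC HH
  refine Finset.sum_congr rfl fun I _ => ?_
  unfold chi hh
  rw [maxIn_xel hF I _ (by omega) (by omega)]
  simp only [d1, d2, false_imp_iff, and_true]

theorem at_valley (hF : IsFence t α) (hodd : t % 2 = 1) (x : J t α) (i : ℕ) (h1 : 1 ≤ i)
    (h2 : i < t) (hp : i % 2 = 0) : CC x (m α i) = (orb x).card - HH x (m α i) := by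
  have hn := nn_add hF
  have hs := seg_pos hF i h2
  have hs' := seg_pos hF (i - 1) (by omega)
  have hle := m_mono α (show i + 1 ≤ t from h2)
  have e : i - 1 + 1 = i := by omega
  rw [e] at hs'
  have d1 : ¬ Dn t α (m α i) := by rw [dn_iff h2 le_rfl hs]; omega
  have d2 : ¬ Up t α (m α i - 1) := by
    rw [up_iff (i := i - 1) (by omega) (by omega) (by rw [e]; omega)]; omega
  rw [chi_rho]
  unfold HH
  rw [Finset.card_eq_sum_ones, Nat.cast_sum, ← Finset.sum_sub_distrib]
  refine Finset.sum_congr rfl fun I _ => ?_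
  unfold hh
  rw [minOut_xel hF hodd I _ (by omega) (by omega)]
  simp only [d1, d2, false_imp_iff, and_true]
  by_cases ha : Mem' I (m α i) <;> simp [ha]

theorem HH_zero (x : J t α) : HH x 0 = (orb x).card := by
  simp [HH, hh, mem'_zero]

theorem HH_top (hF : IsFence t α) (x : J t α) : HH x (m α t) = 0 := by
  have hn := nn_add hF
  unfold HH hh
  exact Finset.sum_eq_zero fun I _ => by rw [if_neg (mem'_top I _ (by omega))]

theorem m_pal (hpal : ∀ i, 1 ≤ i → i ≤ t → α (i - 1) = α (t - i)) (i : ℕ) (hi : i ≤ t) :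
    m α i + m α (t - i) = m α t := by
  induction i with
  | zero => simp [m_zero]
  | succ i ih =>
    have h1 := ih (by omega)
    have h2 := m_succ α i
    have h3 := m_succ α (t - (i + 1))
    have h4 := hpal (i + 1) (by omega) hi
    rw [show t - (i + 1) + 1 = t - i by omega] at h3
    simp only [Nat.add_sub_cancel] at h4
    omega

theorem second_diff (hF : IsFence t α) (hodd : t % 2 = 1) (x : J t α) (i j : ℕ) (hi : i < t)
    (h1 : m α i < j) (h2 : j < m α (i + 1)) : HH x (j + 1) + HH x (j - 1) = 2 * HH x j := by
  rcases Nat.mod_two_eq_zero_or_one i with hp | hp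
  · have := interior_up hF hodd x i j hi h1 h2 hp
    linarith [this.1, this.2]
  · have := interior_dn hF hodd x i j hi h1 h2 hp
    linarith [this.1, this.2]

theorem affine_zero (g : ℕ → ℝ) (a b : ℕ) (ha : g a = 0) (hb : g b = 0)
    (h : ∀ j, a < j → j < b → g (j + 1) + g (j - 1) = 2 * g j) :
    ∀ j, a ≤ j → j ≤ b → g j = 0 := by
  have key : ∀ d, a + d + 1 ≤ b → g (a + d) = d * g (a + 1) ∧ g (a + d + 1) = (d + 1) * g (a + 1) := by
    intro d
    induction d with
    | zero => intro _; simp [ha]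
    | succ d ih =>
      intro hd
      obtain ⟨h1, h2⟩ := ih (by omega)
      have h3 := h (a + d + 1) (by omega) (by omega)
      rw [Nat.add_sub_cancel] at h3
      constructor
      · rw [← add_assoc, h2]; push_cast; ring
      · rw [← add_assoc]; push_cast; linarith
  intro j hj1 hj2
  rcases Nat.eq_or_lt_of_le hj1 with rfl | hlt
  · exact ha
  obtain ⟨e, rfl⟩ : ∃ e, b = a + e + 1 := ⟨b - a - 1, by omega⟩
  have h1 := (key e le_rfl).2
  rw [hb] at h1
  have h2 : g (a + 1) = 0 := by
    rcases mul_eq_zero.mp h1.symm with h | h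
    · have : (0 : ℝ) ≤ e := Nat.cast_nonneg e
      linarith
    · exact h
  obtain ⟨d, rfl⟩ : ∃ d, j = a + d + 1 := ⟨j - a - 1, by omega⟩
  rw [(key d hj2).2, h2, mul_zero]

theorem sym_HH (hF : IsFence t α) (hodd : t % 2 = 1)
    (hpal : ∀ i, 1 ≤ i → i ≤ t → α (i - 1) = α (t - i)) (x : J t α)
    (hsh : ∀ i, 1 ≤ i → i ≤ t - 1 → CC x (m α i) = CC x (m α (t - i)))
    (j : ℕ) (hj : j ≤ m α t) : HH x j + HH x (m α t - j) = (orb x).card := by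
  have hbd : ∀ i, i ≤ t → HH x (m α i) + HH x (m α t - m α i) = (orb x).card := by
    intro i hi
    have hm := m_pal hpal i hi
    rw [show m α t - m α i = m α (t - i) by omega]
    rcases Nat.eq_zero_or_pos i with rfl | h0
    · rw [m_zero, HH_zero, Nat.sub_zero, HH_top hF, add_zero]
    rcases Nat.eq_or_lt_of_le hi with rfl | h1
    · rw [Nat.sub_self, m_zero, HH_zero, HH_top hF, zero_add]
    have hs := hsh i h0 (by omega)
    rcases Nat.mod_two_eq_zero_or_one i with hp | hp
    · rw [at_valley hF hodd x i h0 h1 hp, at_peak hF x (t - i) (by omega) (by omega) (by omega)] at hs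
      linarith
    · rw [at_peak hF x i h0 h1 hp,
        at_valley hF hodd x (t - i) (by omega) (by omega) (by omega)] at hs
      linarith
  rcases Nat.eq_or_lt_of_le hj with rfl | hlt
  · exact hbd t le_rfl
  obtain ⟨i, hi, h1, h2⟩ := exists_seg t α j hlt
  have := affine_zero (fun j => HH x j + HH x (m α t - j) - (orb x).card) (m α i) (m α (i + 1))
    (by have := hbd i hi.le; linarith) (by have := hbd (i + 1) hi; linarith)
    (by
      intro k hk1 hk2
      have hm := m_pal hpal i hi.le
      have hm' := m_pal hpal (i + 1) hi
      have e1 := second_diff hF hodd x i k hi hk1 hk2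
      have e2 := second_diff hF hodd x (t - (i + 1)) (m α t - k) (by omega) (by omega)
        (by rw [show t - (i + 1) + 1 = t - i by omega]; omega)
      rw [show m α t - k + 1 = m α t - (k - 1) by omega,
        show m α t - k - 1 = m α t - (k + 1) by omega] at e2
      linarith) j h1 h2.le
  linarith

theorem sym_CC (hF : IsFence t α) (hodd : t % 2 = 1)
    (hpal : ∀ i, 1 ≤ i → i ≤ t → α (i - 1) = α (t - i)) (x : J t α)
    (hsh : ∀ i, 1 ≤ i → i ≤ t - 1 → CC x (m α i) = CC x (m α (t - i)))
    (j : ℕ) (hj1 : 1 ≤ j) (hj : j < m α t) : CC x j = CC x (m α t - j) := by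
  obtain ⟨i, hi, h1, h2⟩ := exists_seg t α j hj
  have hm := m_pal hpal i hi.le
  have hm' := m_pal hpal (i + 1) hi
  rcases Nat.eq_or_lt_of_le h1 with rfl | h1
  · rw [show m α t - m α i = m α (t - i) by omega]
    refine hsh i ?_ (by omega)
    rcases Nat.eq_zero_or_pos i with rfl | h
    · rw [m_zero] at hj1; omega
    · exact h
  have s0 := sym_HH hF hodd hpal x hsh j hj.le
  have s1 := sym_HH hF hodd hpal x hsh (j + 1) hj
  have s2 := sym_HH hF hodd hpal x hsh (j - 1) (by omega)
  have b1 : m α (t - (i + 1)) < m α t - j := by omega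
  have b2 : m α t - j < m α (t - (i + 1) + 1) := by
    rw [show t - (i + 1) + 1 = t - i by omega]; omega
  have r1 : m α t - j + 1 = m α t - (j - 1) := by omega
  have r2 : m α t - j - 1 = m α t - (j + 1) := by omega
  rcases Nat.mod_two_eq_zero_or_one i with hp | hp
  · have e1 := interior_up hF hodd x i j hi h1 h2 hp
    have e2 := interior_up hF hodd x (t - (i + 1)) (m α t - j) (by omega) b1 b2 (by omega)
    rw [r1, r2] at e2
    linarith [e1.1, e2.2]
  · have e1 := interior_dn hF hodd x i j hi h1 h2 hp
    have e2 := interior_dn hF hodd x (t - (i + 1)) (m α t - j) (by omega) b1 b2 (by omega)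
    rw [r1, r2] at e2
    linarith [e1.1, e2.2]

end

/-- Theorem `shared diffs are sufficient`.
Let `α` be palindromic with `t` odd, and suppose `χ_{s_i} − χ_{s_{t−i}}` is 0-mesic under
rowmotion for all `i ∈ [t−1]`. Then for all `k ∈ [n]`:
(1) `χ_{x_k} − χ_{x_{n−k+1}}` is 0-mesic, and (2) `χ̂_{x_k} + χ̂_{x_{n−k+1}}` is 1-mesic. -/
theorem statement11 (t : ℕ) (α : ℕ → ℕ) (hF : IsFence t α) (hodd : t % 2 = 1)
    (hpal : ∀ i, 1 ≤ i → i ≤ t → α (i - 1) = α (t - i))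
    (hmes : ∀ i, 1 ≤ i → i ≤ t - 1 →
      IsMesic (rho t α)
        (fun I => chi t α (sElx t α i) I - chi t α (sElx t α (t - i)) I) 0) :
    (∀ k, 1 ≤ k → k ≤ nn t α →
      IsMesic (rho t α)
        (fun I => chi t α (xel t α k) I - chi t α (xel t α (nn t α - k + 1)) I) 0)
    ∧ (∀ k, 1 ≤ k → k ≤ nn t α →
      IsMesic (rho t α)
        (fun I => chiHat t α (xel t α k) I + chiHat t α (xel t α (nn t α - k + 1)) I) 1) := by
  have hn := nn_add hF
  have hsh : ∀ x : J t α, ∀ i, 1 ≤ i → i ≤ t - 1 → CC x (m α i) = CC x (m α (t - i)) := by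
    intro x i h1 h2
    have := (isMesic_iff _ _).1 (hmes i h1 h2) x
    rw [Finset.sum_sub_distrib, mul_zero] at this
    unfold CC
    unfold sElx at this
    linarith
  constructor
  · intro k h1 h2
    rw [isMesic_iff]
    intro x
    have := sym_CC hF hodd hpal x (hsh x) k h1 (by omega)
    rw [Finset.sum_sub_distrib, mul_zero, show nn t α - k + 1 = m α t - k by omega]
    unfold CC at this
    linarith
  · intro k h1 h2
    rw [isMesic_iff]
    intro x
    have := sym_HH hF hodd hpal x (hsh x) k (by omega)
    rw [Finset.sum_add_distrib, mul_one, ← this, show nn t α - k + 1 = m α t - k by omega]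
    unfold HH
    congr 1
    · exact Finset.sum_congr rfl fun I _ => hh_eq k h1 h2 I
    · exact Finset.sum_congr rfl fun I _ => hh_eq _ (by omega) (by omega) I

end Fence
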